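/- Let c > 0, η₁ ∈ [−3,−1], η₄ ∈ [1,3] with η₄ − η₁ ≤ 4. Then S(η₁) ≤ S(−2−η₁), S(2−η₄) ≤ S(η₄), and S(−2−η₁) ≤ S(η₄). -/

import Mathlib

noncomputable section

/-- ĝ(v) = √π e^{−π² v²}, the Fourier transform of the Gaussian e^{−x²}. -/
def gFT (v : ℝ) : ℝ := Real.sqrt Real.pi * Real.exp (-Real.pi ^ 2 * v ^ 2)

/-- S(η) = (4/π) Σ_{l=0}^∞ (−1)^l ĝ(c(2l+1+(−1)^{l+1} η)) / (2l+1). -/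
def S (c η : ℝ) : ℝ :=
  (4 / Real.pi) * ∑' l : ℕ,
    (-1 : ℝ) ^ l * gFT (c * (2 * (l : ℝ) + 1 + (-1 : ℝ) ^ (l + 1) * η)) / (2 * (l : ℝ) + 1)

def tm (c η : ℝ) (l : ℕ) : ℝ :=
  (-1 : ℝ) ^ l * gFT (c * (2 * (l : ℝ) + 1 + (-1 : ℝ) ^ (l + 1) * η)) / (2 * (l : ℝ) + 1)

theorem S_eq_tm (c η : ℝ) : S c η = (4 / Real.pi) * ∑' l, tm c η l := rfl

theorem gFT_le {c x y : ℝ} (h : x ^ 2 ≤ y ^ 2) : gFT (c * y) ≤ gFT (c * x) := by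
  unfold gFT
  gcongr _ * Real.exp ?_
  have : 0 ≤ Real.pi ^ 2 * c ^ 2 * (y ^ 2 - x ^ 2) :=
    mul_nonneg (by positivity) (by linarith)
  nlinarith

theorem gFT_nonneg (x : ℝ) : 0 ≤ gFT x := by unfold gFT; positivity

theorem summable_tm (c η : ℝ) (hc : 0 < c) : Summable (tm c η) := by
  set A := Real.pi ^ 2 * c ^ 2 with hA
  have hA0 : 0 < A := by positivity
  have hg : Summable (fun l : ℕ => Real.sqrt Real.pi * Real.exp (A * (2 * |η| - 1)) *
      (Real.exp (-(4 * A))) ^ l) := by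
    apply Summable.mul_left
    exact summable_geometric_of_lt_one (by positivity) (by
      rw [Real.exp_lt_one_iff]; linarith)
  refine Summable.of_norm_bounded hg (fun l => ?_)
  have hl : (1 : ℝ) ≤ 2 * (l : ℝ) + 1 := by
    have : (0 : ℝ) ≤ l := Nat.cast_nonneg l
    linarith
  unfold tm
  rw [norm_div, norm_mul, norm_pow, norm_neg, norm_one, one_pow, one_mul, Real.norm_eq_abs,
    Real.norm_eq_abs, abs_of_nonneg (gFT_nonneg _), abs_of_nonneg (by linarith : (0:ℝ) ≤ 2 * (l:ℝ) + 1)]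
  refine (div_le_self (gFT_nonneg _) hl).trans ?_
  unfold gFT
  rw [mul_assoc, ← Real.exp_nat_mul, ← Real.exp_add]
  gcongr _ * Real.exp ?_
  have he : -|η| ≤ (-1 : ℝ) ^ (l + 1) * η := by
    rcases neg_one_pow_eq_or ℝ (l + 1) with h | h <;> rw [h]
    · linarith [neg_abs_le η]
    · linarith [le_abs_self η]
  set e := (-1 : ℝ) ^ (l + 1) * η
  have h2 : 2 * (2 * (l : ℝ) + 1 - |η|) - 1 ≤ (2 * (l : ℝ) + 1 + e) ^ 2 := by
    nlinarith [sq_nonneg (2 * (l : ℝ) + 1 + e - 1)]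
  have h3 := mul_le_mul_of_nonneg_left h2 hA0.le
  rw [mul_pow]
  have : -Real.pi ^ 2 * (c ^ 2 * (2 * (l : ℝ) + 1 + e) ^ 2) = -(A * (2 * (l : ℝ) + 1 + e) ^ 2) := by
    rw [hA]; ring
  rw [this]
  nlinarith

theorem S_mono (c : ℝ) (hc : 0 < c) {x y : ℝ} (hx : -3 ≤ x) (hxy : x ≤ y) (hy : y ≤ 1) :
    S c x ≤ S c y := by
  rw [S_eq_tm, S_eq_tm]
  refine mul_le_mul_of_nonneg_left ?_ (by positivity)
  refine (summable_tm c x hc).tsum_le_tsum (fun l => ?_) (summable_tm c y hc)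
  unfold tm
  have hl : (0 : ℝ) ≤ l := Nat.cast_nonneg l
  refine div_le_div_of_nonneg_right ?_ (by linarith)
  rcases Nat.even_or_odd l with h | h
  · rw [h.neg_one_pow, h.add_one.neg_one_pow, one_mul, one_mul]
    apply gFT_le
    apply pow_le_pow_left₀ <;> linarith
  · rw [h.neg_one_pow, h.add_one.neg_one_pow, neg_one_mul, neg_one_mul]
    apply neg_le_neg
    apply gFT_le
    have : (1 : ℝ) ≤ l := by exact_mod_cast h.pos
    apply pow_le_pow_left₀ <;> linarith

theorem tm_zero (c η : ℝ) : tm c η 0 = gFT (c * (1 - η)) := by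
  unfold tm
  simp [sub_eq_add_neg]

theorem tm_odd (c η : ℝ) (m : ℕ) :
    tm c η (2 * m + 1) = -(gFT (c * (4 * m + 3 + η)) / (4 * m + 3)) := by
  unfold tm
  have h : Odd (2 * m + 1) := ⟨m, rfl⟩
  rw [h.neg_one_pow, h.add_one.neg_one_pow]
  push_cast
  ring_nf

theorem tm_even (c η : ℝ) (m : ℕ) :
    tm c η (2 * m + 1 + 1) = gFT (c * (4 * m + 5 - η)) / (4 * m + 5) := by
  unfold tm
  have h : Even (2 * m + 1 + 1) := ⟨m + 1, by ring⟩
  rw [h.neg_one_pow, h.add_one.neg_one_pow]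
  push_cast
  ring_nf

theorem hasSum_tm (c η : ℝ) (hc : 0 < c) :
    Summable (fun m : ℕ => tm c η (2 * m + 1) + tm c η (2 * m + 1 + 1)) ∧
    ∑' l, tm c η l = tm c η 0 + ∑' m : ℕ, (tm c η (2 * m + 1) + tm c η (2 * m + 1 + 1)) := by
  have hs := summable_tm c η hc
  have h1 : Summable (fun m : ℕ => tm c η (2 * m + 1)) :=
    hs.comp_injective (i := fun m : ℕ => 2 * m + 1) (fun a b h => by simpa using h)
  have h2 : Summable (fun m : ℕ => tm c η (2 * m + 1 + 1)) :=
    hs.comp_injective (i := fun m : ℕ => 2 * m + 1 + 1) (fun a b h => by simpa using h)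
  refine ⟨h1.add h2, ?_⟩
  rw [hs.tsum_eq_zero_add, h1.tsum_add h2]
  congr 1
  exact (tsum_even_add_odd (f := fun n => tm c η (n + 1)) h1 h2).symm

theorem S_refl (c : ℝ) (hc : 0 < c) {t : ℝ} (ht : 0 ≤ t) : S c (1 - t) ≤ S c (1 + t) := by
  rw [S_eq_tm, S_eq_tm]
  refine mul_le_mul_of_nonneg_left ?_ (by positivity)
  obtain ⟨s1, e1⟩ := hasSum_tm c (1 - t) hc
  obtain ⟨s2, e2⟩ := hasSum_tm c (1 + t) hc
  rw [e1, e2]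
  refine add_le_add ?_ (s1.tsum_le_tsum (fun m => ?_) s2)
  · rw [tm_zero, tm_zero]
    apply gFT_le
    apply le_of_eq; ring
  · rw [tm_odd, tm_odd, tm_even, tm_even]
    have hm : (0 : ℝ) ≤ m := Nat.cast_nonneg m
    rw [show (4 * (m:ℝ) + 3 + (1 - t)) = 4 * m + 4 - t by ring,
      show (4 * (m:ℝ) + 3 + (1 + t)) = 4 * m + 4 + t by ring,
      show (4 * (m:ℝ) + 5 - (1 - t)) = 4 * m + 4 + t by ring,
      show (4 * (m:ℝ) + 5 - (1 + t)) = 4 * m + 4 - t by ring]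
    have hg : gFT (c * (4 * m + 4 + t)) ≤ gFT (c * (4 * m + 4 - t)) := by
      apply gFT_le
      nlinarith
    have a1 := div_le_div_of_nonneg_right hg (by linarith : (0:ℝ) ≤ 4 * m + 3)
    have a2 := div_le_div_of_nonneg_right hg (by linarith : (0:ℝ) ≤ 4 * m + 5)
    linarith

/-- for c > 0, η₁ ∈ [−3,−1], η₄ ∈ [1,3] with η₄ − η₁ ≤ 4,
S(η₁) ≤ S(−2−η₁), S(2−η₄) ≤ S(η₄), and S(−2−η₁) ≤ S(η₄). -/
theorem S_inequalities (c : ℝ) (hc : 0 < c) (η₁ η₄ : ℝ)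
    (h1 : η₁ ∈ Set.Icc (-3 : ℝ) (-1)) (h4 : η₄ ∈ Set.Icc (1 : ℝ) 3)
    (hdiff : η₄ - η₁ ≤ 4) :
    S c η₁ ≤ S c (-2 - η₁) ∧ S c (2 - η₄) ≤ S c η₄ ∧ S c (-2 - η₁) ≤ S c η₄ := by
  obtain ⟨h1a, h1b⟩ := h1
  obtain ⟨h4a, h4b⟩ := h4
  have key : S c (2 - η₄) ≤ S c η₄ := by
    have := S_refl c hc (t := η₄ - 1) (by linarith)
    rwa [show 1 - (η₄ - 1) = 2 - η₄ by ring, show 1 + (η₄ - 1) = η₄ by ring] at this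
  exact ⟨S_mono c hc h1a (by linarith) (by linarith), key,
    (S_mono c hc (by linarith) (by linarith) (by linarith)).trans key⟩

end
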